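/- Let n ∈ [5/2, 3) be a real number. There exists a constant C < ∞ depending only on n such that for all ε ∈ (0,1) and all r ∈ ℝ one has |(F_ε²)'''(r) + 4 ((F_ε')²)'(r)| ≤ C G_ε(r)^{(3−n)/(n−2)}, where (F_ε²)''' denotes the third derivative of the function r ↦ F_ε(r)² and ((F_ε')²)' denotes the first derivative of the function r ↦ (F_ε'(r))². -/

import Mathlib

open MeasureTheory

/-- `F_ε(r) = (r² + ε²)^(n/4)` -/
noncomputable def Feps (n ε r : ℝ) : ℝ := (r ^ 2 + ε ^ 2) ^ (n / 4)

/-- `G_ε(r) = ∫_r^∞ ∫_{r'}^∞ (r''² + ε²)^(-n/2) dr'' dr'` -/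
noncomputable def Geps (n ε r : ℝ) : ℝ :=
  ∫ r' in Set.Ioi r, ∫ r'' in Set.Ioi r', (r'' ^ 2 + ε ^ 2) ^ (-(n / 2))

/-- A nonnegative function dominates, on a half-line, the rectangle of height `f b`
over an interval on which it is bounded below by `f b`. -/
lemma sub_mul_le_setIntegral_Ioi {f : ℝ → ℝ} {r a b : ℝ} (hra : r ≤ a) (hab : a ≤ b)
    (hf : IntegrableOn f (Set.Ioi r)) (hnn : ∀ x, 0 ≤ f x) (hfb : ∀ x ∈ Set.Ioc a b, f b ≤ f x) :
    (b - a) * f b ≤ ∫ x in Set.Ioi r, f x := by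
  have hsub : Set.Ioc a b ⊆ Set.Ioi r := fun x hx => lt_of_le_of_lt hra hx.1
  calc (b - a) * f b = ∫ _ in Set.Ioc a b, f b := by simp [hab]
    _ ≤ ∫ x in Set.Ioc a b, f x :=
        setIntegral_mono_on (by simp) (hf.mono_set hsub) measurableSet_Ioc hfb
    _ ≤ ∫ x in Set.Ioi r, f x :=
        setIntegral_mono_set hf (Filter.Eventually.of_forall hnn) hsub.eventuallyLE

lemma continuous_sq_add_sq_rpow {ε : ℝ} (hε : 0 < ε) (a : ℝ) :
    Continuous fun s : ℝ => (s ^ 2 + ε ^ 2) ^ a :=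
  Continuous.rpow_const (by fun_prop) fun s => Or.inl (by positivity)

lemma sq_add_sq_rpow_le_rpow {n ε s : ℝ} (hn : 0 < n) (hs : 0 < s) :
    (s ^ 2 + ε ^ 2) ^ (-(n / 2)) ≤ s ^ (-n) := by
  have h : s ^ (-n) = (s ^ 2) ^ (-(n / 2)) := by
    rw [← Real.rpow_natCast, ← Real.rpow_mul hs.le]
    congr 1
    push_cast
    ring
  rw [h]
  exact Real.rpow_le_rpow_of_nonpos (by positivity) (by nlinarith [sq_nonneg ε]) (by linarith)

lemma integrableOn_Ioi_sq_add_sq_rpow {n ε : ℝ} (hn : 1 < n) (hε : 0 < ε) (r : ℝ) :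
    IntegrableOn (fun s : ℝ => (s ^ 2 + ε ^ 2) ^ (-(n / 2))) (Set.Ioi r) := by
  have hc := continuous_sq_add_sq_rpow hε (-(n / 2))
  have h1 : IntegrableOn (fun s : ℝ => (s ^ 2 + ε ^ 2) ^ (-(n / 2))) (Set.Ioi 1) := by
    refine Integrable.mono' (integrableOn_Ioi_rpow_of_lt (a := -n) (by linarith) one_pos)
      hc.aestronglyMeasurable ?_
    filter_upwards [ae_restrict_mem measurableSet_Ioi] with s hs
    have hs0 : (0 : ℝ) < s := one_pos.trans hs
    rw [Real.norm_of_nonneg (by positivity)]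
    exact sq_add_sq_rpow_le_rpow (by linarith) hs0
  refine ((hc.integrableOn_Icc (a := r) (b := 1)).union h1).mono_set fun x hx => ?_
  rcases le_or_gt x 1 with h | h
  · exact Or.inl ⟨le_of_lt hx, h⟩
  · exact Or.inr h

lemma antitone_setIntegral_Ioi {f : ℝ → ℝ} (hf : ∀ r, IntegrableOn f (Set.Ioi r))
    (hnn : ∀ x, 0 ≤ f x) : Antitone fun r => ∫ s in Set.Ioi r, f s := fun a _ hab =>
  setIntegral_mono_set (hf a) (Filter.Eventually.of_forall hnn)
    (Set.Ioi_subset_Ioi hab).eventuallyLE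

lemma integrableOn_Ioi_setIntegral_sq_add_sq_rpow {n ε : ℝ} (hn : 2 < n) (hε : 0 < ε) (r : ℝ) :
    IntegrableOn (fun r' => ∫ s in Set.Ioi r', (s ^ 2 + ε ^ 2) ^ (-(n / 2))) (Set.Ioi r) := by
  have hg := integrableOn_Ioi_sq_add_sq_rpow (n := n) (by linarith) hε
  have hanti := antitone_setIntegral_Ioi hg fun s => by positivity
  have h1 : IntegrableOn (fun r' => ∫ s in Set.Ioi r', (s ^ 2 + ε ^ 2) ^ (-(n / 2)))
      (Set.Ioi 1) := by
    refine Integrable.mono' ((integrableOn_Ioi_rpow_of_lt (a := -n + 1) (by linarith)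
      one_pos).const_mul (n - 1)⁻¹) hanti.measurable.aestronglyMeasurable ?_
    filter_upwards [ae_restrict_mem measurableSet_Ioi] with t ht
    have ht0 : (0 : ℝ) < t := one_pos.trans ht
    rw [Real.norm_of_nonneg (setIntegral_nonneg measurableSet_Ioi fun s _ => by positivity)]
    calc ∫ s in Set.Ioi t, (s ^ 2 + ε ^ 2) ^ (-(n / 2)) ≤ ∫ s in Set.Ioi t, s ^ (-n) :=
          setIntegral_mono_on (hg t) (integrableOn_Ioi_rpow_of_lt (by linarith) ht0)
            measurableSet_Ioi fun s hs =>
              sq_add_sq_rpow_le_rpow (by linarith) (ht0.trans hs)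
      _ = (n - 1)⁻¹ * t ^ (-n + 1) := by
          rw [integral_Ioi_rpow_of_lt (by linarith) ht0]
          have h : n - 1 ≠ 0 := by linarith
          have h' : -n + 1 ≠ 0 := by linarith
          field_simp
          ring
  refine (((hanti.antitoneOn _).integrableOn_isCompact (isCompact_Icc (a := r) (b := 1))).union
    h1).mono_set fun x hx => ?_
  rcases le_or_gt x 1 with h | h
  · exact Or.inl ⟨le_of_lt hx, h⟩
  · exact Or.inr h

/-- With `R = √(r² + ε²)`, one has `G_ε(r) ≥ 10^(-n/2) R^(2-n)`. -/
lemma rpow_mul_sqrt_rpow_le_Geps {n ε : ℝ} (hn : 2 < n) (hε : 0 < ε) (r : ℝ) :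
    (10 : ℝ) ^ (-(n / 2)) * √(r ^ 2 + ε ^ 2) ^ (2 - n) ≤ Geps n ε r := by
  set R := √(r ^ 2 + ε ^ 2) with hR
  have hR0 : 0 < R := Real.sqrt_pos.2 (by positivity)
  have hR2 : R ^ 2 = r ^ 2 + ε ^ 2 := Real.sq_sqrt (by positivity)
  have hrR : r ≤ R := Real.le_sqrt_of_sq_le (by nlinarith)
  have hg := integrableOn_Ioi_sq_add_sq_rpow (n := n) (by linarith) hε
  have hanti := antitone_setIntegral_Ioi hg fun s => by positivity
  have houter := sub_mul_le_setIntegral_Ioi hrR (show R ≤ 2 * R by linarith)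
    (integrableOn_Ioi_setIntegral_sq_add_sq_rpow hn hε r)
    (fun t => setIntegral_nonneg measurableSet_Ioi fun s _ => by positivity)
    fun t ht => hanti ht.2
  have hinner := sub_mul_le_setIntegral_Ioi le_rfl (show 2 * R ≤ 3 * R by linarith)
    (hg (2 * R)) (fun s => by positivity) fun s hs =>
      Real.rpow_le_rpow_of_nonpos (by positivity)
        (by nlinarith [hs.1, hs.2]) (by linarith)
  have hval : (10 : ℝ) ^ (-(n / 2)) * R ^ (-n) ≤ ((3 * R) ^ 2 + ε ^ 2) ^ (-(n / 2)) := by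
    have h : R ^ (-n) = (R ^ 2) ^ (-(n / 2)) := by
      rw [← Real.rpow_natCast, ← Real.rpow_mul hR0.le]
      congr 1
      push_cast
      ring
    rw [h, ← Real.mul_rpow (by norm_num) (by positivity)]
    exact Real.rpow_le_rpow_of_nonpos (by positivity) (by nlinarith [sq_nonneg r])
      (by linarith)
  have hpow : R ^ (2 - n) = R * (R * R ^ (-n)) := by
    rw [sub_eq_add_neg, Real.rpow_add hR0, Real.rpow_two]
    ring
  calc (10 : ℝ) ^ (-(n / 2)) * R ^ (2 - n)
      = R * (R * ((10 : ℝ) ^ (-(n / 2)) * R ^ (-n))) := by rw [hpow]; ring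
    _ ≤ R * (R * ((3 * R) ^ 2 + ε ^ 2) ^ (-(n / 2))) := by gcongr
    _ ≤ R * ∫ s in Set.Ioi (2 * R), (s ^ 2 + ε ^ 2) ^ (-(n / 2)) := by
        gcongr
        linarith
    _ ≤ Geps n ε r := by
        unfold Geps
        linarith

lemma hasDerivAt_sq_add_sq_rpow {ε : ℝ} (hε : 0 < ε) (a r : ℝ) :
    HasDerivAt (fun s : ℝ => (s ^ 2 + ε ^ 2) ^ a) (2 * a * r * (r ^ 2 + ε ^ 2) ^ (a - 1)) r := by
  have h : HasDerivAt (fun s : ℝ => s ^ 2 + ε ^ 2) (2 * r) r := by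
    simpa using (hasDerivAt_pow 2 r).add_const (ε ^ 2)
  convert h.rpow_const (p := a) (Or.inl (by positivity)) using 1
  ring

lemma hasDerivAt_pow_mul_sq_add_sq_rpow {ε : ℝ} (hε : 0 < ε) (k : ℕ) (a r : ℝ) :
    HasDerivAt (fun s : ℝ => s ^ k * (s ^ 2 + ε ^ 2) ^ a)
      (k * r ^ (k - 1) * (r ^ 2 + ε ^ 2) ^ a
        + 2 * a * (r ^ (k + 1) * (r ^ 2 + ε ^ 2) ^ (a - 1))) r := by
  refine ((hasDerivAt_pow k r).fun_mul (hasDerivAt_sq_add_sq_rpow hε a r)).congr_deriv ?_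
  ring

lemma Feps_sq {ε : ℝ} (hε : 0 < ε) (n s : ℝ) :
    Feps n ε s ^ 2 = (s ^ 2 + ε ^ 2) ^ (n / 2) := by
  rw [Feps, ← Real.rpow_natCast, ← Real.rpow_mul (by positivity)]
  congr 1
  push_cast
  ring

lemma iteratedDeriv_three_Feps_sq {ε : ℝ} (hε : 0 < ε) (n r : ℝ) :
    iteratedDeriv 3 (fun s => Feps n ε s ^ 2) r =
      3 * n * (n - 2) * (r * (r ^ 2 + ε ^ 2) ^ (n / 2 - 2))
        + n * (n - 2) * (n - 4) * (r ^ 3 * (r ^ 2 + ε ^ 2) ^ (n / 2 - 3)) := by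
  have h1 : deriv (fun s => Feps n ε s ^ 2) =
      fun s => n * (s ^ 1 * (s ^ 2 + ε ^ 2) ^ (n / 2 - 1)) := by
    funext s
    simp only [Feps_sq hε]
    rw [(hasDerivAt_sq_add_sq_rpow hε (n / 2) s).deriv]
    ring
  have h2 : deriv (fun s => n * (s ^ 1 * (s ^ 2 + ε ^ 2) ^ (n / 2 - 1))) =
      fun s => n * ((s ^ 2 + ε ^ 2) ^ (n / 2 - 1)
        + (n - 2) * (s ^ 2 * (s ^ 2 + ε ^ 2) ^ (n / 2 - 2))) := by
    funext s
    rw [((hasDerivAt_pow_mul_sq_add_sq_rpow hε 1 (n / 2 - 1) s).const_mul n).deriv,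
      show n / 2 - 1 - 1 = n / 2 - 2 by ring]
    simp only [Nat.cast_one, Nat.sub_self, pow_zero]
    ring
  rw [iteratedDeriv_succ', iteratedDeriv_succ', iteratedDeriv_one, h1, h2,
    (((hasDerivAt_sq_add_sq_rpow hε (n / 2 - 1) r).fun_add
      ((hasDerivAt_pow_mul_sq_add_sq_rpow hε 2 (n / 2 - 2) r).const_mul (n - 2))).const_mul
        n).deriv, show n / 2 - 1 - 1 = n / 2 - 2 by ring, show n / 2 - 2 - 1 = n / 2 - 3 by ring]
  norm_num
  ring

lemma deriv_deriv_Feps_sq {ε : ℝ} (hε : 0 < ε) (n r : ℝ) :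
    deriv (fun s => deriv (Feps n ε) s ^ 2) r =
      n ^ 2 / 2 * (r * (r ^ 2 + ε ^ 2) ^ (n / 2 - 2))
        + n ^ 2 * (n - 4) / 4 * (r ^ 3 * (r ^ 2 + ε ^ 2) ^ (n / 2 - 3)) := by
  have h1 : (fun s => deriv (Feps n ε) s ^ 2) =
      fun s => n ^ 2 / 4 * (s ^ 2 * (s ^ 2 + ε ^ 2) ^ (n / 2 - 2)) := by
    funext s
    have h : (s ^ 2 + ε ^ 2) ^ (n / 2 - 2) = ((s ^ 2 + ε ^ 2) ^ (n / 4 - 1)) ^ 2 := by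
      rw [← Real.rpow_natCast (_ ^ (n / 4 - 1)) 2, ← Real.rpow_mul (by positivity)]
      congr 1
      push_cast
      ring
    rw [h, show Feps n ε = fun s => (s ^ 2 + ε ^ 2) ^ (n / 4) from rfl,
      (hasDerivAt_sq_add_sq_rpow hε (n / 4) s).deriv]
    ring
  rw [h1, ((hasDerivAt_pow_mul_sq_add_sq_rpow hε 2 (n / 2 - 2) r).const_mul (n ^ 2 / 4)).deriv,
    show n / 2 - 2 - 1 = n / 2 - 3 by ring]
  norm_num
  ring

lemma abs_pow_mul_sq_add_sq_rpow_le {ε : ℝ} (hε : 0 < ε) (k : ℕ) (a r : ℝ) :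
    |r ^ k * (r ^ 2 + ε ^ 2) ^ a| ≤ √(r ^ 2 + ε ^ 2) ^ (k + 2 * a) := by
  have hR0 : 0 < √(r ^ 2 + ε ^ 2) := Real.sqrt_pos.2 (by positivity)
  have hrR : |r| ≤ √(r ^ 2 + ε ^ 2) := Real.abs_le_sqrt (by nlinarith)
  have h : (r ^ 2 + ε ^ 2) ^ a = √(r ^ 2 + ε ^ 2) ^ (2 * a) := by
    rw [Real.rpow_mul hR0.le, Real.rpow_two, Real.sq_sqrt (by positivity)]
  rw [h, Real.rpow_add hR0, Real.rpow_natCast, abs_mul, abs_pow, abs_of_pos (by positivity :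
    0 < √(r ^ 2 + ε ^ 2) ^ (2 * a))]
  gcongr

/-- For `n ∈ [5/2, 3)` there is a constant `C` depending only on `n` such that
for all `ε ∈ (0,1)` and all `r`,
`|(F_ε²)'''(r) + 4 ((F_ε')²)'(r)| ≤ C G_ε(r)^((3-n)/(n-2))`. -/
theorem Feps_sq_third_deriv_bound_n_lt_three (n : ℝ) (hn : n ∈ Set.Ico (5 / 2 : ℝ) 3) :
    ∃ C : ℝ, ∀ ε ∈ Set.Ioo (0 : ℝ) 1, ∀ r : ℝ,
      |iteratedDeriv 3 (fun s => (Feps n ε s) ^ 2) r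
          + 4 * deriv (fun s => (deriv (Feps n ε) s) ^ 2) r|
        ≤ C * (Geps n ε r) ^ ((3 - n) / (n - 2)) := by
  obtain ⟨hn1, hn2⟩ := hn
  have hn0 : 2 < n := by linarith
  set p := (3 - n) / (n - 2) with hp
  have hp0 : 0 ≤ p := div_nonneg (by linarith) (by linarith)
  set A := 3 * n * (n - 2) + 4 * (n ^ 2 / 2) with hA
  set B := n * (n - 2) * (n - 4) + 4 * (n ^ 2 * (n - 4) / 4) with hB
  set c := (10 : ℝ) ^ (-(n / 2)) with hc
  have hc0 : 0 < c := by positivity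
  refine ⟨(|A| + |B|) * (c ^ p)⁻¹, fun ε hε r => ?_⟩
  have hε0 : 0 < ε := hε.1
  have hR0 : 0 < √(r ^ 2 + ε ^ 2) := Real.sqrt_pos.2 (by positivity)
  have hG : c ^ p * √(r ^ 2 + ε ^ 2) ^ (n - 3) ≤ Geps n ε r ^ p := by
    have h := Real.rpow_le_rpow (by positivity) (rpow_mul_sqrt_rpow_le_Geps hn0 hε0 r) hp0
    rw [Real.mul_rpow hc0.le (by positivity), ← Real.rpow_mul hR0.le] at h
    have hexp : (2 - n) * p = n - 3 := by
      have : n - 2 ≠ 0 := by linarith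
      rw [hp]
      field_simp
      ring
    rwa [hexp] at h
  have h1 := abs_pow_mul_sq_add_sq_rpow_le hε0 1 (n / 2 - 2) r
  have h3 := abs_pow_mul_sq_add_sq_rpow_le hε0 3 (n / 2 - 3) r
  rw [show ((1 : ℕ) : ℝ) + 2 * (n / 2 - 2) = n - 3 by push_cast; ring, pow_one] at h1
  rw [show ((3 : ℕ) : ℝ) + 2 * (n / 2 - 3) = n - 3 by push_cast; ring] at h3
  rw [iteratedDeriv_three_Feps_sq hε0, deriv_deriv_Feps_sq hε0]
  calc _ = |A * (r * (r ^ 2 + ε ^ 2) ^ (n / 2 - 2))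
          + B * (r ^ 3 * (r ^ 2 + ε ^ 2) ^ (n / 2 - 3))| := by
        congr 1
        rw [hA, hB]
        ring
    _ ≤ |A| * √(r ^ 2 + ε ^ 2) ^ (n - 3) + |B| * √(r ^ 2 + ε ^ 2) ^ (n - 3) := by
        refine (abs_add_le _ _).trans ?_
        rw [abs_mul A, abs_mul B]
        gcongr
    _ = (|A| + |B|) * ((c ^ p)⁻¹ * (c ^ p * √(r ^ 2 + ε ^ 2) ^ (n - 3))) := by
        have : c ^ p ≠ 0 := by positivity
        field_simp
    _ ≤ (|A| + |B|) * (c ^ p)⁻¹ * Geps n ε r ^ p := by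
        rw [mul_assoc]
        gcongr
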